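/- Let n ≥ 1, let ψ ∈ ℂⁿ be a fixed unit vector, let w_1,…,w_d ≥ 0 with ∑_{i=1}^d w_i = 1, let U_1,…,U_d be unitary n×n matrices, and let Φ^C be the associated conjugate channel. Then for every t ∈ [0,1], σ_n{ θ : ‖Φ^C(θ ψ*)‖₂ > t } ≤ d² (1 − t²)^{n−1}. -/

import Mathlib

open scoped BigOperators
open MeasureTheory Matrix

/-- The Frobenius (Hilbert–Schmidt) norm of a matrix. -/
noncomputable def frobNorm {d : ℕ} (K : Matrix (Fin d) (Fin d) ℂ) : ℝ :=
  Real.sqrt (∑ i, ∑ j, ‖K i j‖ ^ 2)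

open scoped ENNReal

theorem lintegral_fin_pi_prod_eq_pow {E : Type*} [MeasureSpace E]
    [SigmaFinite (volume : Measure E)] {f : E → ℝ≥0∞} (hf : Measurable f) (m : ℕ) :
    ∫⁻ x : Fin m → E, ∏ i, f (x i) = (∫⁻ x, f x) ^ m := by
  induction m with
  | zero => simp [volume_pi]
  | succ m ih =>
    have hmp := (volume_preserving_piFinSuccAbove (fun _ : Fin (m + 1) => E) 0).symm
    rw [← hmp.lintegral_comp_emb (MeasurableEquiv.measurableEmbedding _)]
    simp only [Fin.prod_univ_succ, MeasurableEquiv.piFinSuccAbove_symm_apply,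
      Fin.insertNthEquiv_zero, Fin.consEquiv_apply, Fin.cons_zero, Fin.cons_succ]
    rw [Measure.volume_eq_prod, lintegral_prod_mul (f := f) (g := fun y : Fin m → E => ∏ i, f (y i))
      hf.aemeasurable (Finset.measurable_fun_prod _ fun i _ =>
        hf.comp (measurable_pi_apply i)).aemeasurable, ih, pow_succ']

theorem Complex.setLIntegral_exp_neg_mul_sq {a b : ℝ} (ha : 0 ≤ a) (hb : 0 < b) :
    ∫⁻ z in {z : ℂ | a ≤ ‖z‖ ^ 2}, ENNReal.ofReal (Real.exp (-(b * ‖z‖ ^ 2))) =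
      ENNReal.ofReal (Real.pi / b * Real.exp (-(b * a))) := by
  have hrad : ∫⁻ r in Set.Ioi (Real.sqrt a), ENNReal.ofReal (r * Real.exp (-(b * r ^ 2))) =
      ENNReal.ofReal (1 / (2 * b) * Real.exp (-(b * a))) := by
    have hderiv : ∀ r ∈ Set.Ici (Real.sqrt a),
        HasDerivAt (fun r => -(1 / (2 * b)) * Real.exp (-(b * r ^ 2)))
          (r * Real.exp (-(b * r ^ 2))) r := fun r _ => by
      have h := ((((hasDerivAt_pow 2 r).const_mul b).neg).exp).const_mul (-(1 / (2 * b)))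
      refine h.congr_deriv ?_
      have : b ≠ 0 := hb.ne'
      simp
      field_simp
    have hpos : ∀ r ∈ Set.Ioi (Real.sqrt a), 0 ≤ r * Real.exp (-(b * r ^ 2)) := fun r hr =>
      mul_nonneg ((Real.sqrt_nonneg a).trans (le_of_lt hr)) (Real.exp_pos _).le
    have hlim : Filter.Tendsto (fun r : ℝ => -(1 / (2 * b)) * Real.exp (-(b * r ^ 2)))
        Filter.atTop (nhds 0) := by
      rw [← mul_zero (-(1 / (2 * b)))]
      refine (Real.tendsto_exp_neg_atTop_nhds_zero.comp
        ((Filter.tendsto_pow_atTop two_ne_zero).const_mul_atTop hb)).const_mul _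
    rw [← ofReal_integral_eq_lintegral_ofReal
      (integrableOn_Ioi_deriv_of_nonneg' hderiv hpos hlim)
      (ae_restrict_of_forall_mem measurableSet_Ioi hpos),
      integral_Ioi_of_hasDerivAt_of_nonneg' hderiv hpos hlim, Real.sq_sqrt ha]
    congr 1
    ring
  have hS : MeasurableSet {z : ℂ | a ≤ ‖z‖ ^ 2} := measurableSet_le (by fun_prop) (by fun_prop)
  rw [← lintegral_indicator hS, ← Complex.lintegral_comp_polarCoord_symm, polarCoord_target,
    Measure.volume_eq_prod, ← Measure.prod_restrict]
  have hfun : ∀ᵐ p ∂((volume.restrict (Set.Ioi (0 : ℝ))).prod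
      (volume.restrict (Set.Ioo (-Real.pi) Real.pi))),
      ENNReal.ofReal p.1 • Set.indicator {z : ℂ | a ≤ ‖z‖ ^ 2}
        (fun z => ENNReal.ofReal (Real.exp (-(b * ‖z‖ ^ 2)))) (Complex.polarCoord.symm p) =
      Set.indicator (Set.Ici (Real.sqrt a))
        (fun r => ENNReal.ofReal (r * Real.exp (-(b * r ^ 2)))) p.1 * 1 := by
    rw [Measure.prod_restrict]
    refine ae_restrict_of_forall_mem (measurableSet_Ioi.prod measurableSet_Ioo) fun p hp => ?_
    have hp1 : 0 < p.1 := hp.1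
    have hiff : Real.sqrt a ≤ p.1 ↔ a ≤ p.1 ^ 2 := Real.sqrt_le_left hp1.le
    by_cases h : a ≤ p.1 ^ 2
    · rw [Set.indicator_of_mem (by simpa using h), Set.indicator_of_mem (by simpa [hiff] using h)]
      simp [ENNReal.ofReal_mul hp1.le]
    · rw [Set.indicator_of_notMem (by simpa using h),
        Set.indicator_of_notMem (by simpa [hiff] using h)]
      simp
  rw [lintegral_congr_ae hfun, lintegral_prod_mul
    (f := Set.indicator (Set.Ici (Real.sqrt a))
        (fun r => ENNReal.ofReal (r * Real.exp (-(b * r ^ 2))))) (g := fun _ => 1)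
    (Measurable.aemeasurable (Measurable.indicator (by fun_prop) measurableSet_Ici))
    aemeasurable_const, setLIntegral_one, Real.volume_Ioo,
    lintegral_indicator measurableSet_Ici, Measure.restrict_restrict measurableSet_Ici]
  have hae : (Set.Ici (Real.sqrt a) ∩ Set.Ioi 0 : Set ℝ) =ᵐ[volume] Set.Ioi (Real.sqrt a) := by
    rcases (Real.sqrt_nonneg a).eq_or_lt with h | h
    · rw [← h, Set.inter_eq_right.mpr Set.Ioi_subset_Ici_self]
      exact ae_eq_refl _
    · have hsub : Set.Ici (Real.sqrt a) ⊆ Set.Ioi 0 := fun r hr => h.trans_le hr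
      rw [Set.inter_eq_left.mpr hsub]
      exact Ioi_ae_eq_Ici.symm
  rw [Measure.restrict_congr_set hae, hrad, ← ENNReal.ofReal_mul (by positivity)]
  congr 1
  field_simp
  ring

theorem volume_map_mulVec_of_mem_unitaryGroup {n : ℕ} {V : Matrix (Fin n) (Fin n) ℂ}
    (hV : V ∈ Matrix.unitaryGroup (Fin n) ℂ) :
    Measure.map (Matrix.mulVec V) (volume : Measure (Fin n → ℂ)) = volume := by
  let f : (Fin n → ℂ) →ₗ[ℝ] (Fin n → ℂ) := (Matrix.toLin' V).restrictScalars ℝ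
  have hsq : Complex.normSq V.det = 1 := by
    have h := (Matrix.det_of_mem_unitary hV).2
    rw [Complex.star_def, Complex.mul_conj] at h
    exact_mod_cast h
  have hdet : LinearMap.det f = 1 := by
    rw [show LinearMap.det f = Algebra.norm ℝ (LinearMap.det (Matrix.toLin' V)) from
      LinearMap.det_restrictScalars, LinearMap.det_toLin', Algebra.norm_complex_apply, hsq]
  have h := Measure.map_linearMap_addHaar_eq_smul_addHaar (volume : Measure (Fin n → ℂ))
    (f := f) (by rw [hdet]; exact one_ne_zero)
  rw [hdet, inv_one, abs_one, ENNReal.ofReal_one, one_smul] at h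
  exact h

theorem Matrix.sum_norm_sq_mulVec_of_mem_unitaryGroup {n : ℕ} {V : Matrix (Fin n) (Fin n) ℂ}
    (hV : V ∈ Matrix.unitaryGroup (Fin n) ℂ) (x : Fin n → ℂ) :
    ∑ i, ‖(V *ᵥ x) i‖ ^ 2 = ∑ i, ‖x i‖ ^ 2 := by
  have key : ∀ y : Fin n → ℂ, ((∑ i, ‖y i‖ ^ 2 : ℝ) : ℂ) = star y ⬝ᵥ y := fun y => by
    simp [dotProduct, Complex.conj_mul']
  have : ((∑ i, ‖(V *ᵥ x) i‖ ^ 2 : ℝ) : ℂ) = ((∑ i, ‖x i‖ ^ 2 : ℝ) : ℂ) := by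
    rw [key, key, Matrix.star_mulVec, ← Matrix.dotProduct_mulVec, Matrix.mulVec_mulVec,
      ← Matrix.star_eq_conjTranspose, Matrix.mem_unitaryGroup_iff'.mp hV, Matrix.one_mulVec]
  exact_mod_cast this

theorem Matrix.exists_unitaryGroup_smul_mulVec_single {m : ℕ} {φ : Fin (m + 1) → ℂ} (hφ : φ ≠ 0) :
    ∃ V ∈ Matrix.unitaryGroup (Fin (m + 1)) ℂ, ∃ r : ℝ, 0 < r ∧
      φ = (r : ℂ) • V *ᵥ Pi.single 0 1 := by
  set x : EuclideanSpace ℂ (Fin (m + 1)) := WithLp.toLp 2 φ with hx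
  have hx0 : x ≠ 0 := by simpa [hx] using hφ
  have hr : 0 < ‖x‖ := norm_pos_iff.mpr hx0
  have hon : Orthonormal ℂ (({0} : Set (Fin (m + 1))).domRestrict
      fun _ => ((‖x‖⁻¹ : ℝ) : ℂ) • x) := by
    refine ⟨fun i => ?_, fun i j hij => (hij (Subsingleton.elim i j)).elim⟩
    simp [norm_smul, hr.ne']
  obtain ⟨b, hb⟩ := hon.exists_orthonormalBasis_extension_of_card_eq (by simp)
  refine ⟨_, (EuclideanSpace.basisFun (Fin (m + 1)) ℂ).toMatrix_orthonormalBasis_mem_unitary b,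
    ‖x‖, hr, ?_⟩
  ext i
  have h0 : b 0 = ((‖x‖⁻¹ : ℝ) : ℂ) • x := hb 0 rfl
  have hr' : (‖x‖ : ℂ) ≠ 0 := by exact_mod_cast hr.ne'
  simp only [Matrix.mulVec_single_one, Pi.smul_apply, Matrix.col_apply,
    Module.Basis.toMatrix_apply, h0]
  simp [hx]
  exact (mul_inv_cancel_left₀ hr' (φ i)).symm

theorem Complex.lintegral_exp_neg_mul_sq {b : ℝ} (hb : 0 < b) :
    ∫⁻ z : ℂ, ENNReal.ofReal (Real.exp (-(b * ‖z‖ ^ 2))) = ENNReal.ofReal (Real.pi / b) := by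
  have h := Complex.setLIntegral_exp_neg_mul_sq le_rfl hb
  have huniv : {z : ℂ | (0 : ℝ) ≤ ‖z‖ ^ 2} = Set.univ :=
    Set.eq_univ_of_forall fun z => sq_nonneg ‖z‖
  simpa [huniv] using h

theorem ofReal_exp_neg_mul_sum_norm_sq {ι : Type*} [Fintype ι] (b : ℝ) (y : ι → ℂ) :
    ENNReal.ofReal (Real.exp (-(b * ∑ i, ‖y i‖ ^ 2))) =
      ∏ i, ENNReal.ofReal (Real.exp (-(b * ‖y i‖ ^ 2))) := by
  rw [← ENNReal.ofReal_prod_of_nonneg fun i _ => (Real.exp_pos _).le, ← Real.exp_sum,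
    Finset.sum_neg_distrib, Finset.mul_sum]

theorem lintegral_exp_neg_mul_sum_norm_sq {b : ℝ} (hb : 0 < b) (m : ℕ) :
    ∫⁻ y : Fin m → ℂ, ENNReal.ofReal (Real.exp (-(b * ∑ i, ‖y i‖ ^ 2))) =
      ENNReal.ofReal (Real.pi / b) ^ m := by
  simp_rw [ofReal_exp_neg_mul_sum_norm_sq]
  rw [lintegral_fin_pi_prod_eq_pow (f := fun z : ℂ => ENNReal.ofReal (Real.exp (-(b * ‖z‖ ^ 2))))
    (by fun_prop), Complex.lintegral_exp_neg_mul_sq hb]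

/-- The unnormalized standard Gaussian measure on `ℂⁿ`. -/
noncomputable def complexGaussian (n : ℕ) : Measure (Fin n → ℂ) :=
  volume.withDensity fun x => ENNReal.ofReal (Real.exp (-(1 * ∑ i, ‖x i‖ ^ 2)))

theorem complexGaussian_univ (n : ℕ) :
    complexGaussian n Set.univ = ENNReal.ofReal Real.pi ^ n := by
  rw [complexGaussian, withDensity_apply _ MeasurableSet.univ, Measure.restrict_univ,
    lintegral_exp_neg_mul_sum_norm_sq one_pos, div_one]

instance (n : ℕ) : IsFiniteMeasure (complexGaussian n) :=
  ⟨by rw [complexGaussian_univ]; exact ENNReal.pow_lt_top ENNReal.ofReal_lt_top⟩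

theorem measurable_mulVec {n : ℕ} (V : Matrix (Fin n) (Fin n) ℂ) :
    Measurable (Matrix.mulVec V) :=
  (Continuous.matrix_mulVec continuous_const continuous_id).measurable

theorem complexGaussian_map_mulVec {n : ℕ} {V : Matrix (Fin n) (Fin n) ℂ}
    (hV : V ∈ Matrix.unitaryGroup (Fin n) ℂ) :
    Measure.map (Matrix.mulVec V) (complexGaussian n) = complexGaussian n := by
  ext A hA
  rw [Measure.map_apply (measurable_mulVec V) hA, complexGaussian,
    withDensity_apply _ (measurable_mulVec V hA), withDensity_apply _ hA]
  conv_rhs => rw [← volume_map_mulVec_of_mem_unitaryGroup hV,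
    setLIntegral_map hA (by fun_prop) (measurable_mulVec V)]
  simp_rw [Matrix.sum_norm_sq_mulVec_of_mem_unitaryGroup hV]

theorem complexGaussian_ratio_le (m : ℕ) {t : ℝ} (ht0 : 0 ≤ t) (ht1 : t ≤ 1) :
    complexGaussian (m + 1) {x | t ^ 2 * ∑ i, ‖x i‖ ^ 2 < ‖x 0‖ ^ 2} ≤
      ENNReal.ofReal ((1 - t ^ 2) ^ m) * complexGaussian (m + 1) Set.univ := by
  rcases ht1.eq_or_lt with rfl | ht1
  · have hempty : {x : Fin (m + 1) → ℂ | (1 : ℝ) ^ 2 * ∑ i, ‖x i‖ ^ 2 < ‖x 0‖ ^ 2} = ∅ := by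
      refine Set.eq_empty_of_forall_notMem fun x hx => ?_
      have := Finset.single_le_sum (f := fun i => ‖x i‖ ^ 2) (fun i _ => sq_nonneg ‖x i‖)
        (Finset.mem_univ 0)
      simp only [Set.mem_ofPred_eq, one_pow, one_mul] at hx
      exact absurd hx this.not_gt
    rw [hempty, measure_empty]
    exact zero_le
  have hs : 0 < 1 - t ^ 2 := by nlinarith
  set c : ℝ := t ^ 2 / (1 - t ^ 2) with hc
  have hc0 : 0 ≤ c := by positivity
  let B : Set (ℂ × (Fin m → ℂ)) := {p | c * ∑ i, ‖p.2 i‖ ^ 2 ≤ ‖p.1‖ ^ 2}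
  have hB : MeasurableSet B := measurableSet_le (by fun_prop) (by fun_prop)
  let e := (MeasurableEquiv.piFinSuccAbove (fun _ : Fin (m + 1) => ℂ) 0)
  have hmp : MeasurePreserving e.symm volume volume :=
    (volume_preserving_piFinSuccAbove (fun _ : Fin (m + 1) => ℂ) 0).symm
  have hsub : {x : Fin (m + 1) → ℂ | t ^ 2 * ∑ i, ‖x i‖ ^ 2 < ‖x 0‖ ^ 2} ⊆ e.symm '' B := by
    intro x hx
    refine ⟨e x, ?_, e.symm_apply_apply x⟩
    simp only [Set.mem_ofPred_eq, Fin.sum_univ_succ] at hx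
    change c * ∑ i : Fin m, ‖x i.succ‖ ^ 2 ≤ ‖x 0‖ ^ 2
    rw [hc, div_mul_eq_mul_div, div_le_iff₀ hs]
    linarith
  have hinner : ∀ y : Fin m → ℂ, ∫⁻ z : ℂ, B.indicator
      (fun p => ENNReal.ofReal (Real.exp (-(1 * ‖p.1‖ ^ 2))) *
        ENNReal.ofReal (Real.exp (-(1 * ∑ i, ‖p.2 i‖ ^ 2)))) (z, y) =
      ENNReal.ofReal Real.pi *
        ENNReal.ofReal (Real.exp (-((1 + c) * ∑ i, ‖y i‖ ^ 2))) := by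
    intro y
    have hS : MeasurableSet {z : ℂ | c * ∑ i, ‖y i‖ ^ 2 ≤ ‖z‖ ^ 2} :=
      measurableSet_le (by fun_prop) (by fun_prop)
    change ∫⁻ z : ℂ, {z : ℂ | c * ∑ i, ‖y i‖ ^ 2 ≤ ‖z‖ ^ 2}.indicator
      (fun z => ENNReal.ofReal (Real.exp (-(1 * ‖z‖ ^ 2))) *
        ENNReal.ofReal (Real.exp (-(1 * ∑ i, ‖y i‖ ^ 2)))) z = _
    rw [lintegral_indicator hS, lintegral_mul_const _ (by fun_prop),
      Complex.setLIntegral_exp_neg_mul_sq (by positivity) one_pos,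
      ← ENNReal.ofReal_mul (by positivity), ← ENNReal.ofReal_mul (by positivity), div_one,
      mul_assoc, ← Real.exp_add]
    congr 3
    ring
  have hpi : Real.pi / (1 + c) = (1 - t ^ 2) * Real.pi := by
    rw [hc]
    field_simp
    ring
  refine (measure_mono hsub).trans (le_of_eq ?_)
  rw [complexGaussian_univ, complexGaussian, withDensity_apply _ (e.symm.measurableSet_image.mpr hB),
    ← hmp.setLIntegral_comp_emb e.symm.measurableEmbedding, ← lintegral_indicator hB]
  have hdens : ∀ p : ℂ × (Fin m → ℂ),
      ENNReal.ofReal (Real.exp (-(1 * ∑ i, ‖e.symm p i‖ ^ 2))) =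
      ENNReal.ofReal (Real.exp (-(1 * ‖p.1‖ ^ 2))) *
        ENNReal.ofReal (Real.exp (-(1 * ∑ i, ‖p.2 i‖ ^ 2))) := fun p => by
    rw [← ENNReal.ofReal_mul (Real.exp_pos _).le, ← Real.exp_add, Fin.sum_univ_succ]
    congr 2
    change -(1 * (‖p.1‖ ^ 2 + ∑ i : Fin m, ‖p.2 i‖ ^ 2)) = _
    ring
  simp_rw [hdens]
  rw [Measure.volume_eq_prod, lintegral_prod_symm' _ (Measurable.indicator (by fun_prop) hB)]
  simp_rw [hinner]
  rw [lintegral_const_mul _ (by fun_prop), lintegral_exp_neg_mul_sum_norm_sq (by positivity), hpi,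
    ENNReal.ofReal_mul hs.le, mul_pow, ENNReal.ofReal_pow hs.le, pow_succ']
  ring

/-- The squared overlap of `φ` and `θ` exceeds `t²` times the product of their squared norms. -/
def LargeOverlap {n : ℕ} (t : ℝ) (φ θ : Fin n → ℂ) : Prop :=
  t ^ 2 * (∑ i, ‖φ i‖ ^ 2) * (∑ i, ‖θ i‖ ^ 2) < ‖star φ ⬝ᵥ θ‖ ^ 2

namespace LargeOverlap

variable {n : ℕ} {t : ℝ}

theorem comm {φ θ : Fin n → ℂ} : LargeOverlap t φ θ ↔ LargeOverlap t θ φ := by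
  have h : ‖star φ ⬝ᵥ θ‖ = ‖star θ ⬝ᵥ φ‖ := by
    rw [← norm_star, Matrix.star_dotProduct, star_star]
  rw [LargeOverlap, LargeOverlap, h, mul_right_comm]

theorem measurableSet_prod :
    MeasurableSet {p : (Fin n → ℂ) × (Fin n → ℂ) | LargeOverlap t p.1 p.2} := by
  unfold LargeOverlap dotProduct
  exact measurableSet_lt (by fun_prop) (Measurable.pow_const (Measurable.norm
    (Finset.measurable_fun_sum _ fun i _ => Continuous.measurable
      (by simp only [Pi.star_apply]; fun_prop))) 2)

theorem measurableSet (φ : Fin n → ℂ) : MeasurableSet {θ | LargeOverlap t φ θ} :=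
  measurable_prodMk_left measurableSet_prod

theorem smul_mulVec_iff {V : Matrix (Fin n) (Fin n) ℂ} (hV : V ∈ Matrix.unitaryGroup (Fin n) ℂ)
    {r : ℝ} (hr : 0 < r) (φ θ : Fin n → ℂ) :
    LargeOverlap t ((r : ℂ) • V *ᵥ φ) (V *ᵥ θ) ↔ LargeOverlap t φ θ := by
  have h1 : star ((r : ℂ) • V *ᵥ φ) ⬝ᵥ (V *ᵥ θ) = (r : ℂ) * (star φ ⬝ᵥ θ) := by
    rw [star_smul, Matrix.star_mulVec, smul_dotProduct, ← Matrix.dotProduct_mulVec,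
      Matrix.mulVec_mulVec, ← Matrix.star_eq_conjTranspose, Matrix.mem_unitaryGroup_iff'.mp hV,
      Matrix.one_mulVec]
    simp
  have h2 : ∑ i, ‖((r : ℂ) • V *ᵥ φ) i‖ ^ 2 = r ^ 2 * ∑ i, ‖φ i‖ ^ 2 := by
    rw [← Matrix.sum_norm_sq_mulVec_of_mem_unitaryGroup hV φ, Finset.mul_sum]
    simp [mul_pow]
  rw [LargeOverlap, LargeOverlap, h1, h2, Matrix.sum_norm_sq_mulVec_of_mem_unitaryGroup hV,
    norm_mul, mul_pow, Complex.norm_real, Real.norm_eq_abs, sq_abs,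
    show t ^ 2 * (r ^ 2 * ∑ i, ‖φ i‖ ^ 2) * ∑ i, ‖θ i‖ ^ 2 =
      r ^ 2 * (t ^ 2 * (∑ i, ‖φ i‖ ^ 2) * ∑ i, ‖θ i‖ ^ 2) by ring]
  exact mul_lt_mul_iff_right₀ (by positivity)

theorem measure_eq_single {m : ℕ} {μ : Measure (Fin (m + 1) → ℂ)}
    (hinv : ∀ V ∈ Matrix.unitaryGroup (Fin (m + 1)) ℂ, Measure.map (Matrix.mulVec V) μ = μ)
    {φ : Fin (m + 1) → ℂ} (hφ : φ ≠ 0) :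
    μ {θ | LargeOverlap t φ θ} = μ {θ | LargeOverlap t (Pi.single 0 1) θ} := by
  obtain ⟨V, hV, r, hr, rfl⟩ := Matrix.exists_unitaryGroup_smul_mulVec_single hφ
  conv_lhs => rw [← hinv V hV, Measure.map_apply (measurable_mulVec V) (measurableSet _)]
  simp only [Set.preimage_ofPred_eq, smul_mulVec_iff hV hr]

theorem single_iff {m : ℕ} (θ : Fin (m + 1) → ℂ) :
    LargeOverlap t (Pi.single 0 1) θ ↔ t ^ 2 * ∑ i, ‖θ i‖ ^ 2 < ‖θ 0‖ ^ 2 := by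
  have h1 : ∑ i, ‖(Pi.single 0 1 : Fin (m + 1) → ℂ) i‖ ^ 2 = 1 := by
    simp [Fin.sum_univ_succ]
  have h2 : star (Pi.single 0 1 : Fin (m + 1) → ℂ) ⬝ᵥ θ = θ 0 := by
    simp [dotProduct, Fin.sum_univ_succ]
  rw [LargeOverlap, h1, h2, mul_one]

/-- For a unitarily invariant probability measure that does not charge the origin, the overlap
with a fixed vector has the tail of the uniform measure on the sphere. -/
theorem measure_le {m : ℕ} {σ : Measure (Fin (m + 1) → ℂ)} [IsProbabilityMeasure σ]
    (hinv : ∀ V ∈ Matrix.unitaryGroup (Fin (m + 1)) ℂ, Measure.map (Matrix.mulVec V) σ = σ)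
    (h0 : ∀ᵐ θ ∂σ, θ ≠ 0) (ht0 : 0 ≤ t) (ht1 : t ≤ 1)
    {φ : Fin (m + 1) → ℂ} (hφ : φ ≠ 0) :
    σ {θ | LargeOverlap t φ θ} ≤ ENNReal.ofReal ((1 - t ^ 2) ^ m) := by
  set ν := complexGaussian (m + 1) with hν
  have hν0 : ∀ᵐ x ∂ν, x ≠ 0 :=
    (withDensity_absolutelyContinuous _ _).ae_le (Measure.ae_ne volume 0)
  have hσ : ν.prod σ {p | LargeOverlap t p.1 p.2} =
      σ {θ | LargeOverlap t (Pi.single 0 1) θ} * ν Set.univ := by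
    rw [Measure.prod_apply measurableSet_prod, ← lintegral_const]
    refine lintegral_congr_ae (hν0.mono fun x hx => ?_)
    exact measure_eq_single hinv hx
  have hνσ : ν.prod σ {p | LargeOverlap t p.1 p.2} =
      ν {θ | LargeOverlap t (Pi.single 0 1) θ} := by
    rw [Measure.prod_apply_symm measurableSet_prod,
      ← mul_one (ν {θ | LargeOverlap t (Pi.single 0 1) θ}), ← measure_univ (μ := σ),
      ← lintegral_const]
    refine lintegral_congr_ae (h0.mono fun θ hθ => ?_)
    simp only [Set.preimage_ofPred_eq]
    simp_rw [comm (θ := θ)]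
    exact measure_eq_single (fun V hV => complexGaussian_map_mulVec hV) hθ
  have hmass : ν Set.univ ≠ 0 := by
    rw [hν, complexGaussian_univ]
    exact pow_ne_zero _ (ENNReal.ofReal_pos.mpr Real.pi_pos).ne'
  rw [measure_eq_single hinv hφ,
    ← ENNReal.mul_le_mul_iff_left hmass (measure_ne_top ν _), ← hσ, hνσ]
  simp_rw [single_iff]
  exact complexGaussian_ratio_le m ht0 ht1

end LargeOverlap

theorem trace_vecMulVec_star_mul {n : ℕ} (θ ψ : Fin n → ℂ) (A : Matrix (Fin n) (Fin n) ℂ) :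
    ((Matrix.of fun a b => θ a * star (ψ b)) * A).trace = star (Aᴴ *ᵥ ψ) ⬝ᵥ θ := by
  rw [show (Matrix.of fun a b => θ a * star (ψ b)) = Matrix.vecMulVec θ (star ψ) from rfl,
    Matrix.vecMulVec_mul, Matrix.trace_vecMulVec, Matrix.star_mulVec,
    Matrix.conjTranspose_conjTranspose, dotProduct_comm]

theorem exists_lt_norm_of_lt_frobNorm {d : ℕ} {w : Fin d → ℝ} (hw0 : ∀ i, 0 ≤ w i)
    (hw1 : ∑ i, w i = 1) {K : Fin d → Fin d → ℂ} {t : ℝ} (ht0 : 0 ≤ t)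
    (h : t < frobNorm (Matrix.of fun i j => (Real.sqrt (w i * w j) : ℂ) * K i j)) :
    ∃ i j, t ^ 2 < ‖K i j‖ ^ 2 := by
  by_contra! hK
  refine h.not_ge (Real.sqrt_le_iff.mpr ⟨ht0, ?_⟩)
  calc ∑ i, ∑ j, ‖(Real.sqrt (w i * w j) : ℂ) * K i j‖ ^ 2
      ≤ ∑ i, ∑ j, w i * w j * t ^ 2 := by
        refine Finset.sum_le_sum fun i _ => Finset.sum_le_sum fun j _ => ?_
        have hij := mul_nonneg (hw0 i) (hw0 j)
        rw [norm_mul, mul_pow, Complex.norm_real, Real.norm_eq_abs, sq_abs, Real.sq_sqrt hij]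
        exact mul_le_mul_of_nonneg_left (hK i j) hij
    _ = t ^ 2 := by
        simp_rw [← Finset.sum_mul, ← Finset.mul_sum, hw1, mul_one, hw1, one_mul]

/-- For the uniform probability measure `σ_n` on the unit sphere of `ℂⁿ` — characterized as a
probability measure supported on the unit sphere and invariant under every unitary — a fixed
unit vector `ψ`, and a conjugate channel `Φ^C`, one has
`σ_n{θ : ‖Φ^C(θ ψ*)‖₂ > t} ≤ d² (1 − t²)^{n−1}` for `t ∈ [0,1]`. -/
theorem sphere_conjChannel_offDiag_bound (n d : ℕ) (hn : 1 ≤ n)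
    (ψ : Fin n → ℂ) (hψ : ∑ i, ‖ψ i‖ ^ 2 = 1)
    (w : Fin d → ℝ) (hw0 : ∀ i, 0 ≤ w i) (hw1 : ∑ i, w i = 1)
    (U : Fin d → Matrix (Fin n) (Fin n) ℂ) (hU : ∀ i, U i ∈ Matrix.unitaryGroup (Fin n) ℂ)
    (σ : Measure (Fin n → ℂ)) [IsProbabilityMeasure σ]
    (hsupp : σ {z | ∑ i, ‖z i‖ ^ 2 = 1} = 1)
    (hinv : ∀ V ∈ Matrix.unitaryGroup (Fin n) ℂ, Measure.map (Matrix.mulVec V) σ = σ)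
    (t : ℝ) (ht0 : 0 ≤ t) (ht1 : t ≤ 1) :
    σ {θ | t < frobNorm (Matrix.of fun i j => (Real.sqrt (w i * w j) : ℂ) *
        ((Matrix.of fun a b => θ a * star (ψ b)) * ((U j)ᴴ * U i)).trace)} ≤
      ENNReal.ofReal ((d : ℝ) ^ 2 * (1 - t ^ 2) ^ (n - 1)) := by
  obtain ⟨m, rfl⟩ : ∃ m, n = m + 1 := ⟨n - 1, by omega⟩
  let φ : Fin d → Fin d → Fin (m + 1) → ℂ := fun i j => ((U j)ᴴ * U i)ᴴ *ᵥ ψ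
  have hφ : ∀ i j, ∑ k, ‖φ i j k‖ ^ 2 = 1 := fun i j => by
    rw [← hψ]
    refine Matrix.sum_norm_sq_mulVec_of_mem_unitaryGroup ?_ ψ
    exact Unitary.star_mem (mul_mem (Unitary.star_mem (hU j)) (hU i))
  have hsphere : ∀ᵐ θ ∂σ, ∑ i, ‖θ i‖ ^ 2 = 1 :=
    (prob_compl_eq_zero_iff (measurableSet_eq_fun (by fun_prop) (by fun_prop))).mpr hsupp
  have hne : ∀ x : Fin (m + 1) → ℂ, ∑ i, ‖x i‖ ^ 2 = 1 → x ≠ 0 := by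
    rintro x hx rfl
    simp at hx
  calc _ ≤ σ (⋃ i, ⋃ j, {θ | LargeOverlap t (φ i j) θ}) := by
        refine measure_mono_ae (hsphere.mono fun θ hθ h => ?_)
        obtain ⟨i, j, hij⟩ := exists_lt_norm_of_lt_frobNorm hw0 hw1 ht0 h
        rw [trace_vecMulVec_star_mul] at hij
        refine Set.mem_iUnion₂.mpr ⟨i, j, ?_⟩
        change t ^ 2 * (∑ k, ‖φ i j k‖ ^ 2) * (∑ k, ‖θ k‖ ^ 2) < _
        rw [hφ, hθ, mul_one, mul_one]
        exact hij
    _ ≤ ∑ i : Fin d, ∑ j : Fin d, σ {θ | LargeOverlap t (φ i j) θ} :=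
        (measure_iUnion_fintype_le _ _).trans
          (Finset.sum_le_sum fun i _ => measure_iUnion_fintype_le _ _)
    _ ≤ ∑ _i : Fin d, ∑ _j : Fin d, ENNReal.ofReal ((1 - t ^ 2) ^ m) :=
        Finset.sum_le_sum fun i _ => Finset.sum_le_sum fun j _ =>
          LargeOverlap.measure_le hinv (hsphere.mono hne) ht0 ht1 (hne _ (hφ i j))
    _ = _ := by
        rw [ENNReal.ofReal_mul (by positivity), ENNReal.ofReal_pow (Nat.cast_nonneg d),
          ENNReal.ofReal_natCast]
        simp [sq, mul_assoc]
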